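/- Let K be a valued field with a pseudo-uniformizer t and a lift k̃ of the residue field. Fix positive integers n, d, s, set μ = D_n(d) and V = Σ_{j ∈ Δ_n(d)} |j| (equivalently V = Σ_{k=0}^{d} k·L_n(k)). Let P_1, …, P_μ ∈ (k̃[t]_s)^n and let Δ = det((P_i^j)_{1≤i≤μ, j∈Δ_n(d)}), where for j = (j_1,…,j_n) ∈ Δ_n(d) the symbol P_i^j denotes the product of the coordinates of P_i raised to the powers j_1, …, j_n. Then either Δ = 0 or |Δ| ≥ |t|^{sV}. -/

import Mathlib

/-- The set `Δ_m(k)` of multi-indices in `ℕ^m` of total degree at most `k`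
(coded with coordinates in `Fin (k+1)` to make it a finite type). -/
abbrev DeltaIdx (m k : ℕ) : Type :=
  {α : Fin m → Fin (k + 1) // ∑ i, (α i : ℕ) ≤ k}

/-- `L_m(k)`, the number of multi-indices in `ℕ^m` of total degree exactly `k`,
i.e. the number of monomials of degree exactly `k` in `m` variables. -/
def Lnum (m k : ℕ) : ℕ :=
  Fintype.card {α : Fin m → Fin (k + 1) // ∑ i, (α i : ℕ) = k}

/-- `D_m(k)`, the number of multi-indices in `ℕ^m` of total degree at most `k`,
i.e. the number of monomials of degree at most `k` in `m` variables. -/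
def Dnum (m k : ℕ) : ℕ := Fintype.card (DeltaIdx m k)

/-- `kt` is a lift of the residue field: it is contained in the valuation ring and the
residue map restricts to a bijection from `kt` to the residue field. -/
def IsLift {K Γ : Type*} [Field K] [LinearOrderedCommGroupWithZero Γ]
    (v : Valuation K Γ) (kt : Subfield K) : Prop :=
  (∀ x ∈ kt, v x ≤ 1) ∧ ∀ x : K, v x ≤ 1 → ∃! a : K, a ∈ kt ∧ v (x - a) < 1

/-- The set `k̃[t]_s` of polynomials in `t` of degree `< s` with coefficients in
the lift `kt` of the residue field. -/
def ktPoly {K : Type*} [Field K] (kt : Subfield K) (t : K) (s : ℕ) : Set K :=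
  {x | ∃ a : Fin s → K, (∀ i, a i ∈ kt) ∧ x = ∑ i, a i * t ^ (i : ℕ)}

/-- In a linearly ordered commutative group with zero, `0` is a bottom element. -/
noncomputable instance instOrderBotOfLinearOrderedCommGroupWithZero
    {Γ : Type*} [LinearOrderedCommGroupWithZero Γ] : OrderBot Γ where
  bot := 0
  bot_le _ := zero_le'

/-- `ψ : U ⊆ K^m → K` satisfies `T_r`-approximation: for each `y ∈ U` there is a
polynomial `T_y` of total degree `< r` with coefficients in the valuation ring such that
`|ψ(x) − T_y(x)| ≤ |x − y|^r` for all `x ∈ U`, with the maximum norm on `K^m`. -/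
def TrApprox {K Γ : Type*} [Field K] [LinearOrderedCommGroupWithZero Γ]
    (v : Valuation K Γ) {m : ℕ} (U : Set (Fin m → K))
    (ψ : (Fin m → K) → K) (r : ℕ) : Prop :=
  ∀ y ∈ U, ∃ T : MvPolynomial (Fin m) K,
    T.totalDegree < r ∧ (∀ c, v (T.coeff c) ≤ 1) ∧
    ∀ x ∈ U, v (ψ x - MvPolynomial.eval x T) ≤ (Finset.univ.sup fun i => v (x i - y i)) ^ r

/-- `r(m, μ)`: the unique integer `r` with `D_m(r−1) ≤ μ < D_m(r)`, defined as the least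
`r` with `μ < D_m(r)`. -/
noncomputable def rfun (m μ : ℕ) : ℕ := sInf {x : ℕ | μ < Dnum m x}

/-- `V(n,d) = Σ_{k=0}^{d} k·L_n(k)`. -/
def Vfun (n d : ℕ) : ℕ := ∑ k ∈ Finset.range (d + 1), k * Lnum n k

/-- `e(n,m,d) = Σ_{k=1}^{r−1} k·L_m(k) + r·(μ − D_m(r−1))` where `μ = D_n(d)` and
`r = r(m,d)`. -/
noncomputable def efun (n m d : ℕ) : ℕ :=
  (∑ k ∈ Finset.Icc 1 (rfun m (Dnum n d) - 1), k * Lnum m k) +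
    rfun m (Dnum n d) * (Dnum n d - Dnum m (rfun m (Dnum n d) - 1))

open Polynomial in
/-- A polynomial with integral coefficients takes integral values at integral points. -/
lemma Valuation.aeval_le_one_of_subfield {K Γ : Type*} [Field K]
    [LinearOrderedCommGroupWithZero Γ] (v : Valuation K Γ) {k : Subfield K}
    (hk : ∀ x ∈ k, v x ≤ 1) {t : K} (ht : v t ≤ 1) (p : k[X]) : v (aeval t p) ≤ 1 := by
  rw [aeval_eq_sum_range]
  refine v.map_sum_le fun i _ => ?_
  rw [Subfield.smul_def, smul_eq_mul, map_mul, map_pow]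
  exact mul_le_one' (hk _ (p.coeff i).2) (pow_le_one' ht i)

open Polynomial in
/-- A nonzero polynomial of degree at most `N` over a subfield of integral elements has
valuation at least `v t ^ N` at a topologically small point `t`. -/
lemma Valuation.pow_le_aeval_of_natDegree_le {K Γ : Type*} [Field K]
    [LinearOrderedCommGroupWithZero Γ] (v : Valuation K Γ) {k : Subfield K}
    (hk : ∀ x ∈ k, v x ≤ 1) {t : K} (ht : v t < 1) (N : ℕ) :
    ∀ p : k[X], p ≠ 0 → p.natDegree ≤ N → v t ^ N ≤ v (aeval t p) := by
  have unit_of_ne : ∀ a : k, a ≠ 0 → v (a : K) = 1 := fun a ha => by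
    have ha' : (a : K) ≠ 0 := by simpa using ha
    refine le_antisymm (hk _ a.2) ?_
    have := hk _ (k.inv_mem a.2)
    rw [map_inv₀] at this
    exact (inv_le_one₀ (zero_lt_iff.2 (v.ne_zero_iff.2 ha'))).1 this
  induction N with
  | zero =>
    intro p hp hdeg
    rw [eq_C_of_natDegree_le_zero hdeg] at hp ⊢
    rw [aeval_C, pow_zero]
    exact (unit_of_ne _ (by simpa using hp)).ge
  | succ N ih =>
    intro p hp hdeg
    have hdecomp : aeval t p = aeval t p.divX * t + (p.coeff 0 : K) := by
      conv_lhs => rw [← divX_mul_X_add p]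
      rw [map_add, map_mul, aeval_X, aeval_C]
      rfl
    by_cases h0 : p.coeff 0 = 0
    · have hq : p.divX ≠ 0 := fun hq => hp (by rw [← divX_mul_X_add p, hq, h0]; simp)
      have hqdeg : p.divX.natDegree ≤ N := by
        rw [natDegree_divX_eq_natDegree_tsub_one]; omega
      rw [hdecomp, h0, ZeroMemClass.coe_zero, add_zero, map_mul, pow_succ]
      exact mul_le_mul_left (ih _ hq hqdeg) _
    · have hsmall : v (aeval t p.divX * t) < v (p.coeff 0 : K) := by
        rw [unit_of_ne _ h0, map_mul]
        exact (mul_le_of_le_one_left' (v.aeval_le_one_of_subfield hk ht.le _)).trans_lt ht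
      rw [hdecomp, v.map_add_eq_of_lt_right hsmall, unit_of_ne _ h0]
      exact pow_le_one' ht.le _

open Polynomial in
/-- A determinant of polynomials whose columns have degrees bounded by `b` has degree at most
the sum of these bounds. -/
lemma Matrix.natDegree_det_le_sum {R m : Type*} [CommRing R] [Fintype m] [DecidableEq m]
    (M : Matrix m m R[X]) (b : m → ℕ) (hM : ∀ i l, (M i l).natDegree ≤ b l) :
    M.det.natDegree ≤ ∑ l, b l := by
  rw [Matrix.det_apply]
  refine natDegree_sum_le_of_forall_le _ _ fun σ _ => ?_
  refine (natDegree_smul_le _ _).trans ((natDegree_prod_le _ _).trans ?_)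
  exact Finset.sum_le_sum fun i _ => hM _ _

open Polynomial in
lemma exists_polynomial_of_mem_ktPoly {K : Type*} [Field K] {kt : Subfield K} {t : K} {s : ℕ}
    {x : K} (hx : x ∈ ktPoly kt t s) : ∃ p : kt[X], p.natDegree ≤ s ∧ aeval t p = x := by
  obtain ⟨a, ha, rfl⟩ := hx
  refine ⟨∑ i : Fin s, C ⟨a i, ha i⟩ * X ^ (i : ℕ), ?_, ?_⟩
  · exact natDegree_sum_le_of_forall_le _ _ fun i _ =>
      (natDegree_C_mul_X_pow_le _ _).trans i.2.le
  · simp only [map_sum, map_mul, map_pow, aeval_C, aeval_X]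
    rfl

/-- For points `P_1, …, P_μ ∈ (k̃[t]_s)^n` with `μ = D_n(d)`, the determinant
`Δ = det((P_i^j)_{1≤i≤μ, j∈Δ_n(d)})` satisfies: either `Δ = 0` or `|Δ| ≥ |t|^{sV}`,
where `V = Σ_{j ∈ Δ_n(d)} |j|`. -/
theorem determinant_lower_bound {K Γ : Type*} [Field K] [LinearOrderedCommGroupWithZero Γ]
    (v : Valuation K Γ) (t : K) (ht0 : v t ≠ 0) (ht1 : v t < 1)
    (kt : Subfield K) (hkt : IsLift v kt)
    (n d s : ℕ) (hn : 0 < n) (hd : 0 < d) (hs : 0 < s)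
    (μ : ℕ) (hμ : μ = Dnum n d)
    (ι : Fin μ → DeltaIdx n d) (hι : Function.Bijective ι)
    (P : Fin μ → (Fin n → K)) (hP : ∀ i q, P i q ∈ ktPoly kt t s) :
    Matrix.det (Matrix.of fun i l : Fin μ => ∏ q, P i q ^ (((ι l).1 q : ℕ))) = 0 ∨
    v t ^ (s * ∑ j : DeltaIdx n d, ∑ q, ((j.1 q : ℕ))) ≤
      v (Matrix.det (Matrix.of fun i l : Fin μ => ∏ q, P i q ^ (((ι l).1 q : ℕ)))) := by
  choose Q hQdeg hQ using fun i q => exists_polynomial_of_mem_ktPoly (hP i q)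
  let M : Matrix (Fin μ) (Fin μ) (Polynomial kt) :=
    Matrix.of fun i l => ∏ q, Q i q ^ ((ι l).1 q : ℕ)
  have hdet : Matrix.det (Matrix.of fun i l : Fin μ => ∏ q, P i q ^ ((ι l).1 q : ℕ)) =
      Polynomial.aeval t M.det := by
    rw [AlgHom.map_det (Polynomial.aeval t)]
    congr 1
    ext i l
    simp [M, hQ]
  have hdeg : M.det.natDegree ≤ s * ∑ j : DeltaIdx n d, ∑ q, (j.1 q : ℕ) := by
    rw [← hι.sum_comp (fun j : DeltaIdx n d => ∑ q, (j.1 q : ℕ)), Finset.mul_sum]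
    refine Matrix.natDegree_det_le_sum M _ fun i l => ?_
    rw [Finset.mul_sum]
    refine (Polynomial.natDegree_prod_le Finset.univ fun q => Q i q ^ ((ι l).1 q : ℕ)).trans
      (Finset.sum_le_sum fun q _ => ?_)
    rw [mul_comm]
    exact Polynomial.natDegree_pow_le_of_le _ (hQdeg i q)
  rw [hdet]
  by_cases h0 : M.det = 0
  · left
    rw [h0, map_zero]
  · right
    exact v.pow_le_aeval_of_natDegree_le hkt.1 ht1 _ _ h0 hdeg
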